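/- arXiv:2012.03314 — 2 statements merged into one kernel-verified Lean document; each statement's English description precedes it below -/
import Mathlib

section
/- Fix i ∈ Σ and constants χ₁, χ₂ such that lim_{n→∞} (1/n) log α₁(D_{Π(σⁿi)} S_{i|n}) = χ₁ and lim_{n→∞} (1/n) log α₂(D_{Π(σⁿi)} S_{i|n}) = χ₂. Then for any sequence (a_n)_{n∈ℕ} of points in [0,1]², one also has lim_{n→∞} (1/n) log α₁(D_{a_n} S_{i|n}) = χ₁ and lim_{n→∞} (1/n) log α₂(D_{a_n} S_{i|n}) = χ₂. -/
open MeasureTheory Filter Set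

noncomputable section

namespace FFL

/-- The unit square `[0,1]² ⊆ ℝ²`. -/
def sq : Set (ℝ × ℝ) := Set.Icc (0:ℝ) 1 ×ˢ Set.Icc (0:ℝ) 1

/-- The Euclidean metric on `ℝ²`. -/
def dE (a b : ℝ × ℝ) : ℝ := Real.sqrt ((a.1 - b.1) ^ 2 + (a.2 - b.2) ^ 2)

/-- Squared Frobenius norm of a 2×2 real matrix. -/
def frobSq (A : Matrix (Fin 2) (Fin 2) ℝ) : ℝ := ∑ i, ∑ j, (A i j) ^ 2

/-- The larger singular value `α₁` of a 2×2 real matrix, i.e. the larger positive square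
root of the eigenvalues of `AᵀA`, via the standard closed formula. -/
def sv1 (A : Matrix (Fin 2) (Fin 2) ℝ) : ℝ :=
  Real.sqrt ((frobSq A + Real.sqrt ((frobSq A) ^ 2 - 4 * (A.det) ^ 2)) / 2)

/-- The smaller singular value `α₂` of a 2×2 real matrix. -/
def sv2 (A : Matrix (Fin 2) (Fin 2) ℝ) : ℝ :=
  Real.sqrt ((frobSq A - Real.sqrt ((frobSq A) ^ 2 - 4 * (A.det) ^ 2)) / 2)

/-- The nonlinear, non-conformal iterated function systems of Falconer, Fraser and Lee:
maps `S i (a₁,a₂) = (f i a₁, g i (a₁,a₂))` on the unit square, where `f i`, `g i` are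
`C^{1+α}` contractions (with partial derivatives `fx`, `gx`, `gy`) satisfying the
domination condition. -/
structure System (I : Type) [Fintype I] where
  f : I → ℝ → ℝ
  g : I → ℝ × ℝ → ℝ
  fx : I → ℝ → ℝ
  gx : I → ℝ × ℝ → ℝ
  gy : I → ℝ × ℝ → ℝ
  /-- the index set has at least two elements -/
  card2 : 2 ≤ Fintype.card I
  /-- each `S i` maps the unit square into itself -/
  mapsTo : ∀ i, Set.MapsTo (fun a => (f i a.1, g i a)) sq sq
  /-- `fx i` is the derivative of `f i` on `[0,1]` -/
  hasDeriv_f : ∀ i, ∀ x ∈ Set.Icc (0:ℝ) 1,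
    HasDerivWithinAt (f i) (fx i x) (Set.Icc (0:ℝ) 1) x
  /-- `(gx i, gy i)` is the (total) derivative of `g i` on the unit square -/
  hasDeriv_g : ∀ i, ∀ a ∈ sq, HasFDerivWithinAt (g i)
      (gx i a • ContinuousLinearMap.fst ℝ ℝ ℝ + gy i a • ContinuousLinearMap.snd ℝ ℝ ℝ) sq a
  /-- the derivatives are `α`-Hölder for some `α > 0`, i.e. `f i`, `g i` are `C^{1+α}` -/
  holder : ∃ α > (0:ℝ), ∃ H > (0:ℝ), ∀ i,
      (∀ x ∈ Set.Icc (0:ℝ) 1, ∀ y ∈ Set.Icc (0:ℝ) 1, |fx i x - fx i y| ≤ H * |x - y| ^ α) ∧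
      (∀ a ∈ sq, ∀ b ∈ sq, |gx i a - gx i b| ≤ H * dE a b ^ α) ∧
      (∀ a ∈ sq, ∀ b ∈ sq, |gy i a - gy i b| ≤ H * dE a b ^ α)
  /-- the maps `f i`, `g i` (hence `S i`) are uniform contractions -/
  contracting : ∃ c, 0 ≤ c ∧ c < 1 ∧ ∀ i,
      (∀ x ∈ Set.Icc (0:ℝ) 1, ∀ y ∈ Set.Icc (0:ℝ) 1, |f i x - f i y| ≤ c * |x - y|) ∧
      (∀ a ∈ sq, ∀ b ∈ sq, |g i a - g i b| ≤ c * dE a b) ∧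
      (∀ a ∈ sq, ∀ b ∈ sq, dE (f i a.1, g i a) (f i b.1, g i b) ≤ c * dE a b)
  /-- the domination condition:
  `inf |f_{i,x}| > sup |g_{i,y}| ≥ inf |g_{i,y}| ≥ d > 0` -/
  domination : ∃ d > (0:ℝ), ∀ i,
      d ≤ sInf ((fun a => |gy i a|) '' sq) ∧
      sSup ((fun a => |gy i a|) '' sq) < sInf ((fun x => |fx i x|) '' Set.Icc (0:ℝ) 1)

variable {I : Type} [Fintype I]

/-- The map `S i`. -/
def S (T : System I) (i : I) (a : ℝ × ℝ) : ℝ × ℝ := (T.f i a.1, T.g i a)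

/-- The composition `S_w = S_{i₁} ∘ ⋯ ∘ S_{i_n}` along a finite word `w = (i₁,…,i_n)`. -/
def Sw (T : System I) : List I → ℝ × ℝ → ℝ × ℝ
  | [], a => a
  | i :: w, a => S T i (Sw T w a)

/-- The top-left entry `f_{w,x}(a)` of the (lower triangular) Jacobian `D_a S_w`,
via the chain rule. -/
def fxw (T : System I) : List I → ℝ × ℝ → ℝ
  | [], _ => 1
  | i :: w, a => T.fx i (Sw T w a).1 * fxw T w a

/-- The bottom-right entry `g_{w,y}(a)` of the Jacobian `D_a S_w`. -/
def gyw (T : System I) : List I → ℝ × ℝ → ℝ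
  | [], _ => 1
  | i :: w, a => T.gy i (Sw T w a) * gyw T w a

/-- The off-diagonal entry `g_{w,x}(a)` of the Jacobian `D_a S_w`. -/
def gxw (T : System I) : List I → ℝ × ℝ → ℝ
  | [], _ => 0
  | i :: w, a => T.gx i (Sw T w a) * fxw T w a + T.gy i (Sw T w a) * gxw T w a

/-- The Jacobian matrix `D_a S_w`. -/
def Dmat (T : System I) (w : List I) (a : ℝ × ℝ) : Matrix (Fin 2) (Fin 2) ℝ :=
  !![fxw T w a, 0; gxw T w a, gyw T w a]

/-- The larger singular value `α₁(D_a S_w)`. -/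
def alpha1 (T : System I) (w : List I) (a : ℝ × ℝ) : ℝ := sv1 (Dmat T w a)

/-- The smaller singular value `α₂(D_a S_w)`. -/
def alpha2 (T : System I) (w : List I) (a : ℝ × ℝ) : ℝ := sv2 (Dmat T w a)

/-- The restriction `i|n` of an infinite sequence to its first `n` symbols. -/
def word (ii : ℕ → I) (n : ℕ) : List I := List.ofFn (fun k : Fin n => ii k.1)

/-- The iterated left shift `σⁿ`. -/
def shiftn (ii : ℕ → I) (n : ℕ) : ℕ → I := fun k => ii (k + n)

/-- The left shift `σ` on `Σ = I^ℕ`. -/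
def shift (ii : ℕ → I) : ℕ → I := fun k => ii (k + 1)

/-- The cylinder set `[w] ⊆ Σ` of a finite word `w`. -/
def cyl (w : List I) : Set (ℕ → I) := {jj | ∀ k : Fin w.length, jj k.1 = w.get k}

/-- `F` is the attractor of the IFS: the (unique) nonempty compact subset of the unit
square with `F = ⋃ i, S i '' F`. -/
def IsAttractor (T : System I) (F : Set (ℝ × ℝ)) : Prop :=
  F.Nonempty ∧ IsCompact F ∧ F ⊆ sq ∧ F = ⋃ i, S T i '' F

/-- The strong separation condition: the sets `S i '' F` are pairwise disjoint. -/
def SSC (T : System I) (F : Set (ℝ × ℝ)) : Prop :=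
  ∀ i j : I, i ≠ j → Disjoint (S T i '' F) (S T j '' F)

/-- `Pi` is the canonical coding map `Π : Σ → [0,1]²`:
`Π(i)` is the unique point of `⋂ₙ S_{i|n}([0,1]²)`. -/
def IsCoding (T : System I) (Pi : (ℕ → I) → ℝ × ℝ) : Prop :=
  ∀ ii : ℕ → I, ∀ n : ℕ, Pi ii ∈ Sw T (word ii n) '' sq

/-- `m` is quasi-Bernoulli with constant `L`:
`L⁻¹ m[w] m[v] ≤ m[wv] ≤ L m[w] m[v]` for all finite words `w, v`. -/
def QuasiBernoulli [MeasurableSpace I] (m : Measure (ℕ → I)) (L : ℝ) : Prop :=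
  0 < L ∧ ∀ w v : List I,
    L⁻¹ * (m (cyl w)).toReal * (m (cyl v)).toReal ≤ (m (cyl (w ++ v))).toReal ∧
    (m (cyl (w ++ v))).toReal ≤ L * (m (cyl w)).toReal * (m (cyl v)).toReal

/-- The interval `Q₁(x,r) = [x - r/2, x + r/2]`. -/
def Q1 (x r : ℝ) : Set ℝ := Set.Icc (x - r / 2) (x + r / 2)

/-- The square `Q₂(a,r) = (a₁ - r/2, a₁ + r/2) × (a₂ - r/2, a₂ + r/2)`. -/
def Q2 (a : ℝ × ℝ) (r : ℝ) : Set (ℝ × ℝ) :=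
  Set.Ioo (a.1 - r / 2) (a.1 + r / 2) ×ˢ Set.Ioo (a.2 - r / 2) (a.2 + r / 2)

/-- The approximate square `B_n(a,r)`: points `b ∈ S_w([0,1]²)` with `|b₁ - a₁| ≤ r/2`. -/
def Bn (T : System I) (w : List I) (a : ℝ × ℝ) (r : ℝ) : Set (ℝ × ℝ) :=
  {b ∈ Sw T w '' sq | |b.1 - a.1| ≤ r / 2}

/-- The closed Euclidean ball in `ℝ²`. -/
def ballE (x : ℝ × ℝ) (r : ℝ) : Set (ℝ × ℝ) := {y | dE x y ≤ r}

/-- A measure on `ℝ` is exact dimensional with dimension `s` if for a.e. `x`,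
`log ν(B(x,r)) / log r → s` as `r → 0⁺`. -/
def ExactDim1 (ν : Measure ℝ) (s : ℝ) : Prop :=
  ∀ᵐ x ∂ν, Tendsto (fun r => Real.log (ν (Metric.closedBall x r)).toReal / Real.log r)
    (nhdsWithin 0 (Set.Ioi 0)) (nhds s)

/-- A measure on `ℝ²` is exact dimensional with dimension `s` (w.r.t. Euclidean balls). -/
def ExactDim2 (ν : Measure (ℝ × ℝ)) (s : ℝ) : Prop :=
  ∀ᵐ x ∂ν, Tendsto (fun r => Real.log (ν (ballE x r)).toReal / Real.log r)
    (nhdsWithin 0 (Set.Ioi 0)) (nhds s)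

/-- `η = sup_{i ∈ I, a, b ∈ [0,1]²} |g_{i,y}(a)| / |f_{i,x}(b)|`. -/
def eta (T : System I) : ℝ :=
  sSup {x : ℝ | ∃ i : I, ∃ a ∈ sq, ∃ b ∈ sq, x = |T.gy i a| / |T.fx i b.1|}

end FFL

open FFL

namespace FFL

lemma abs_log_sub_log_abs_le {L s y : ℝ} (hL : 0 < L) (hs : 0 ≤ s) (hy : y ≠ 0)
    (h1 : y ^ 2 ≤ L * s ^ 2) (h2 : s ^ 2 ≤ L * y ^ 2) :
    |Real.log s - Real.log (abs y)| ≤ Real.log L := by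
  have hy2 : 0 < y ^ 2 := by positivity
  have hs0 : s ≠ 0 := by
    rintro rfl
    norm_num at h1
    exact hy h1
  have hs2 : 0 < s ^ 2 := by positivity
  have hL1 : 1 ≤ L := by
    by_contra! h
    nlinarith
  have hl := Real.log_nonneg hL1
  have e1 := Real.log_le_log hy2 h1
  have e2 := Real.log_le_log hs2 h2
  rw [Real.log_mul hL.ne' (by positivity), Real.log_pow, Real.log_pow] at e1 e2
  push_cast at e1 e2
  rw [Real.log_abs, abs_le]
  constructor <;> linarith

lemma sv1_nonneg (A : Matrix (Fin 2) (Fin 2) ℝ) : 0 ≤ sv1 A := Real.sqrt_nonneg _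

lemma sv2_nonneg (A : Matrix (Fin 2) (Fin 2) ℝ) : 0 ≤ sv2 A := Real.sqrt_nonneg _

lemma singular_values_lower_triangular {K f x g : ℝ} (hf : f ≠ 0) (hg : g ≠ 0)
    (hK : 0 ≤ K) (h : x ^ 2 + g ^ 2 ≤ K * f ^ 2) :
    |Real.log (sv1 !![f, 0; x, g]) - Real.log (abs f)| ≤ Real.log (2 * (1 + K)) ∧
    |Real.log (sv2 !![f, 0; x, g]) - Real.log (abs g)| ≤ Real.log (2 * (1 + K)) := by
  have hφ : frobSq !![f, 0; x, g] = f ^ 2 + x ^ 2 + g ^ 2 := by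
    simp [frobSq, Fin.sum_univ_two]; ring
  have hdet : Matrix.det !![f, 0; x, g] = f * g := by simp [Matrix.det_fin_two]
  have hf2 : 0 < f ^ 2 := by positivity
  have hg2 : 0 < g ^ 2 := by positivity
  set φ := f ^ 2 + x ^ 2 + g ^ 2 with hφdef
  have hfφ : f ^ 2 ≤ φ := by rw [hφdef]; nlinarith [sq_nonneg x]
  have hφK : φ ≤ (1 + K) * f ^ 2 := by rw [hφdef]; linarith
  have hφ0 : 0 < φ := hf2.trans_le hfφ
  have hdisc : 0 ≤ φ ^ 2 - 4 * (f * g) ^ 2 := by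
    have : f ^ 2 + g ^ 2 ≤ φ := by rw [hφdef]; nlinarith [sq_nonneg x]
    nlinarith [sq_nonneg (f ^ 2 - g ^ 2)]
  set r := Real.sqrt (φ ^ 2 - 4 * (f * g) ^ 2) with hr
  have hr0 : 0 ≤ r := Real.sqrt_nonneg _
  have hr2 : r ^ 2 = φ ^ 2 - 4 * (f * g) ^ 2 := Real.sq_sqrt hdisc
  have hrφ : r ≤ φ := by
    apply le_of_sq_le_sq _ hφ0.le
    rw [hr2]; nlinarith [sq_nonneg (f * g)]
  have hs1 : sv1 !![f, 0; x, g] ^ 2 = (φ + r) / 2 := by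
    rw [sv1, hφ, hdet, Real.sq_sqrt (by positivity)]
  have hs2 : sv2 !![f, 0; x, g] ^ 2 = (φ - r) / 2 := by
    rw [sv2, hφ, hdet, Real.sq_sqrt (by linarith)]
  have hprod : (φ - r) / 2 * (φ + r) = 2 * (f ^ 2 * g ^ 2) := by nlinarith
  constructor
  · apply abs_log_sub_log_abs_le (by positivity) (sv1_nonneg _) hf
    · rw [hs1]; nlinarith
    · rw [hs1]; nlinarith
  · apply abs_log_sub_log_abs_le (by positivity) (sv2_nonneg _) hg
    · rw [hs2]
      have : g ^ 2 * f ^ 2 ≤ 2 * (1 + K) * ((φ - r) / 2) * f ^ 2 := by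
        have hle : (φ - r) / 2 * (φ + r) ≤ (φ - r) / 2 * (2 * ((1 + K) * f ^ 2)) :=
          mul_le_mul_of_nonneg_left (by linarith) (by linarith)
        nlinarith
      exact le_of_mul_le_mul_right this hf2
    · rw [hs2]
      have : (φ - r) / 2 * f ^ 2 ≤ 2 * g ^ 2 * f ^ 2 := by
        have hle : (φ - r) / 2 * f ^ 2 ≤ (φ - r) / 2 * (φ + r) :=
          mul_le_mul_of_nonneg_left (by linarith) (by linarith)
        nlinarith
      have h2 := le_of_mul_le_mul_right this hf2
      nlinarith

lemma dE_nonneg (a b : ℝ × ℝ) : 0 ≤ dE a b := Real.sqrt_nonneg _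

lemma dE_le_two {a b : ℝ × ℝ} (ha : a ∈ sq) (hb : b ∈ sq) : dE a b ≤ 2 := by
  obtain ⟨⟨h1, h2⟩, h3, h4⟩ := ha
  obtain ⟨⟨k1, k2⟩, k3, k4⟩ := hb
  apply Real.sqrt_le_iff.2
  constructor
  · norm_num
  · nlinarith

lemma abs_fst_sub_le_dE (a b : ℝ × ℝ) : |a.1 - b.1| ≤ dE a b :=
  Real.abs_le_sqrt (by nlinarith [sq_nonneg (a.2 - b.2)])

lemma zero_mem_sq : ((0, 0) : ℝ × ℝ) ∈ sq := by simp [sq]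

variable {I : Type} [Fintype I]

lemma Sw_mem_sq (T : System I) (w : List I) {a : ℝ × ℝ} (ha : a ∈ sq) : Sw T w a ∈ sq := by
  induction w with
  | nil => exact ha
  | cons i w ih => exact T.mapsTo i ih

lemma dE_Sw_le (T : System I) {c : ℝ} (hc0 : 0 ≤ c)
    (hc : ∀ i, ∀ a ∈ sq, ∀ b ∈ sq, dE (S T i a) (S T i b) ≤ c * dE a b)
    (w : List I) {a b : ℝ × ℝ} (ha : a ∈ sq) (hb : b ∈ sq) :
    dE (Sw T w a) (Sw T w b) ≤ c ^ w.length * 2 := by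
  induction w with
  | nil => simpa [Sw] using dE_le_two ha hb
  | cons i w ih =>
    calc dE (Sw T (i :: w) a) (Sw T (i :: w) b)
        ≤ c * dE (Sw T w a) (Sw T w b) := hc i _ (Sw_mem_sq T w ha) _ (Sw_mem_sq T w hb)
      _ ≤ c * (c ^ w.length * 2) := mul_le_mul_of_nonneg_left ih hc0
      _ = c ^ (i :: w).length * 2 := by rw [List.length_cons]; ring

/-- Logarithm of the absolute value is Lipschitz away from zero. -/
lemma abs_log_abs_sub_le {d u v : ℝ} (hd : 0 < d) (hu : d ≤ |u|) (hv : d ≤ |v|) :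
    |Real.log (abs u) - Real.log (abs v)| ≤ |u - v| / d := by
  have key : ∀ u v : ℝ, d ≤ |u| → d ≤ |v| →
      Real.log (abs u) - Real.log (abs v) ≤ |u - v| / d := by
    intro u v hu hv
    have hu0 : 0 < |u| := hd.trans_le hu
    have hv0 : 0 < |v| := hd.trans_le hv
    rw [← Real.log_div hu0.ne' hv0.ne']
    calc Real.log (|u| / |v|) ≤ |u| / |v| - 1 := Real.log_le_sub_one_of_pos (by positivity)
      _ = (|u| - |v|) / |v| := by field_simp
      _ ≤ |u - v| / |v| := by gcongr; exact abs_sub_abs_le_abs_sub u v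
      _ ≤ |u - v| / d := by gcongr
  rw [abs_le]
  have h1 := key u v hu hv
  have h2 := key v u hv hu
  rw [abs_sub_comm] at h2
  constructor <;> linarith

/-- Bounded distortion for cocycles generated by a Hölder potential bounded away from zero. -/
lemma cocycle_distortion (T : System I) {φ : I → ℝ × ℝ → ℝ} {P : List I → ℝ × ℝ → ℝ}
    (hnil : ∀ a, P [] a = 1)
    (hcons : ∀ i w a, P (i :: w) a = φ i (Sw T w a) * P w a)
    {d α H : ℝ} (hd : 0 < d) (hα : 0 < α) (hH : 0 < H)
    (hφd : ∀ i, ∀ a ∈ sq, d ≤ |φ i a|)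
    (hφH : ∀ i, ∀ a ∈ sq, ∀ b ∈ sq, |φ i a - φ i b| ≤ H * dE a b ^ α) :
    ∃ C, ∀ w, ∀ a ∈ sq, ∀ b ∈ sq,
      P w a ≠ 0 ∧ |Real.log (abs (P w a)) - Real.log (abs (P w b))| ≤ C := by
  obtain ⟨c, hc0, hc1, hc⟩ := T.contracting
  have hne : ∀ w, ∀ a ∈ sq, P w a ≠ 0 := by
    intro w a ha
    induction w with
    | nil => simp [hnil]
    | cons i w ih =>
      rw [hcons]
      exact mul_ne_zero (abs_pos.1 (hd.trans_le (hφd i _ (Sw_mem_sq T w ha)))) ih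
  set q := c ^ α with hq
  have hq0 : 0 ≤ q := Real.rpow_nonneg hc0 α
  have hq1 : q < 1 := Real.rpow_lt_one hc0 hc1 hα
  set K := H * 2 ^ α / d with hK
  have hK0 : 0 < K := by positivity
  have hsum : ∀ w, ∀ a ∈ sq, ∀ b ∈ sq, |Real.log (abs (P w a)) - Real.log (abs (P w b))| ≤
      K * ∑ k ∈ Finset.range w.length, q ^ k := by
    intro w a ha b hb
    induction w with
    | nil => simp [hnil]
    | cons i w ih =>
      have hma := Sw_mem_sq T w ha
      have hmb := Sw_mem_sq T w hb
      have hφa := hφd i _ hma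
      have hφb := hφd i _ hmb
      have hstep : |Real.log (abs (φ i (Sw T w a))) - Real.log (abs (φ i (Sw T w b)))| ≤
          K * q ^ w.length := by
        refine (abs_log_abs_sub_le hd hφa hφb).trans ?_
        have h1 : dE (Sw T w a) (Sw T w b) ^ α ≤ q ^ w.length * 2 ^ α := by
          refine (Real.rpow_le_rpow (dE_nonneg _ _)
            (dE_Sw_le T hc0 (fun i => (hc i).2.2) w ha hb) hα.le).trans_eq ?_
          rw [Real.mul_rpow (by positivity) (by norm_num), hq, ← Real.rpow_natCast,
            ← Real.rpow_natCast, ← Real.rpow_mul hc0, ← Real.rpow_mul hc0, mul_comm α]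
        calc _ ≤ H * (q ^ w.length * 2 ^ α) / d := by
              gcongr
              exact (hφH i _ hma _ hmb).trans (mul_le_mul_of_nonneg_left h1 hH.le)
          _ = K * q ^ w.length := by rw [hK]; ring
      rw [hcons, hcons, abs_mul, abs_mul,
        Real.log_mul (hd.trans_le hφa).ne' (abs_ne_zero.2 (hne w a ha)),
        Real.log_mul (hd.trans_le hφb).ne' (abs_ne_zero.2 (hne w b hb)),
        List.length_cons, Finset.sum_range_succ, mul_add, add_sub_add_comm, add_comm]
      exact (abs_add_le _ _).trans (add_le_add ih hstep)
  refine ⟨K * (1 - q)⁻¹, fun w a ha b hb => ⟨hne w a ha, (hsum w a ha b hb).trans ?_⟩⟩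
  refine mul_le_mul_of_nonneg_left ?_ hK0.le
  rw [← tsum_geometric_of_lt_one hq0 hq1]
  exact (summable_geometric_of_lt_one hq0 hq1).sum_le_tsum _ (fun k _ => by positivity)

/-- Uniform form of the domination condition, with a uniform bound on `gx`. -/
lemma System.exists_uniform_bounds (T : System I) : ∃ d > (0:ℝ), ∃ η, 0 ≤ η ∧ η < 1 ∧ ∃ M > (0:ℝ),
    ∀ i, ∀ a ∈ sq, d ≤ |T.gy i a| ∧ d ≤ |T.fx i a.1| ∧
      |T.gy i a| ≤ η * |T.fx i a.1| ∧ |T.gx i a| ≤ M := by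
  obtain ⟨d, hd, hdom⟩ := T.domination
  obtain ⟨α, hα, H, hH, hhol⟩ := T.holder
  have hbdd : ∀ u : ℝ × ℝ → ℝ, (∀ a ∈ sq, ∀ b ∈ sq, |u a - u b| ≤ H * dE a b ^ α) →
      ∀ a ∈ sq, |u a| ≤ |u (0, 0)| + H * 2 ^ α := by
    intro u hu a ha
    have h1 : |u a - u (0, 0)| ≤ H * 2 ^ α := (hu a ha _ zero_mem_sq).trans
      (mul_le_mul_of_nonneg_left (Real.rpow_le_rpow (dE_nonneg _ _)
        (dE_le_two ha zero_mem_sq) hα.le) hH.le)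
    have h2 := abs_sub_abs_le_abs_sub (u a) (u (0, 0))
    linarith
  set s : I → ℝ := fun i => sSup ((fun a => |T.gy i a|) '' sq) with hs
  set t : I → ℝ := fun i => sInf ((fun x => |T.fx i x|) '' Set.Icc (0:ℝ) 1) with ht
  have hgyd : ∀ i, ∀ a ∈ sq, d ≤ |T.gy i a| := fun i a ha =>
    (hdom i).1.trans (csInf_le ⟨0, by rintro _ ⟨b, _, rfl⟩; exact abs_nonneg _⟩ ⟨a, ha, rfl⟩)
  have hgys : ∀ i, ∀ a ∈ sq, |T.gy i a| ≤ s i := fun i a ha =>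
    le_csSup ⟨|T.gy i (0, 0)| + H * 2 ^ α, by
      rintro _ ⟨b, hb, rfl⟩; exact hbdd _ (hhol i).2.2 b hb⟩ ⟨a, ha, rfl⟩
  have hfxt : ∀ i, ∀ a ∈ sq, t i ≤ |T.fx i a.1| := fun i a ha =>
    csInf_le ⟨0, by rintro _ ⟨b, _, rfl⟩; exact abs_nonneg _⟩ ⟨a.1, ha.1, rfl⟩
  have hst : ∀ i, s i < t i := fun i => (hdom i).2
  have hs0 : ∀ i, 0 < s i := fun i =>
    hd.trans_le ((hgyd i _ zero_mem_sq).trans (hgys i _ zero_mem_sq))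
  have hne : (Finset.univ : Finset I).Nonempty :=
    Finset.card_pos.1 (by have := T.card2; rw [Finset.card_univ]; omega)
  obtain ⟨j, -, hj⟩ := Finset.exists_max_image Finset.univ (fun i => s i / t i) hne
  refine ⟨d, hd, s j / t j, (div_pos (hs0 j) ((hs0 j).trans (hst j))).le,
    (div_lt_one ((hs0 j).trans (hst j))).2 (hst j),
    ∑ i, |T.gx i (0, 0)| + H * 2 ^ α, by positivity, ?_⟩
  intro i a ha
  have ht0 : 0 < t i := (hs0 i).trans (hst i)
  refine ⟨hgyd i a ha, ?_, ?_, ?_⟩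
  · exact ((hgyd i a ha).trans (hgys i a ha)).trans ((hst i).le.trans (hfxt i a ha))
  · calc |T.gy i a| ≤ s i := hgys i a ha
      _ = s i / t i * t i := by field_simp
      _ ≤ s j / t j * |T.fx i a.1| := by
        exact mul_le_mul (hj i (Finset.mem_univ i)) (hfxt i a ha) ht0.le
          (div_pos (hs0 j) ((hs0 j).trans (hst j))).le
  · refine (hbdd _ (hhol i).2.1 a ha).trans ?_
    gcongr
    exact Finset.single_le_sum (f := fun i => |T.gx i (0, 0)|)
      (fun i _ => abs_nonneg _) (Finset.mem_univ i)

/-- The first column dominates the remaining entries of the Jacobian, uniformly in the word. -/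
lemma exists_entries_le (T : System I) : ∃ K ≥ (0:ℝ), ∀ w, ∀ a ∈ sq,
    gxw T w a ^ 2 + gyw T w a ^ 2 ≤ K * fxw T w a ^ 2 := by
  obtain ⟨d, hd, η, hη0, hη1, M, hM, h⟩ := T.exists_uniform_bounds
  have hη : 0 < 1 - η := by linarith
  set R := M / d / (1 - η) with hR
  have hR0 : 0 < R := by positivity
  have hRM : M / d + η * R = R := by rw [hR]; field_simp; ring
  have key : ∀ w, ∀ a ∈ sq, |gxw T w a| ≤ R * |fxw T w a| ∧ |gyw T w a| ≤ |fxw T w a| := by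
    intro w a ha
    induction w with
    | nil => simp [gxw, fxw, gyw, hR0.le]
    | cons i w ih =>
      obtain ⟨hgd, hfd, hgf, hgx⟩ := h i _ (Sw_mem_sq T w ha)
      have hMf : |T.gx i (Sw T w a)| ≤ M / d * |T.fx i (Sw T w a).1| := by
        refine hgx.trans ?_
        rw [div_mul_eq_mul_div, le_div_iff₀ hd]
        exact mul_le_mul_of_nonneg_left hfd hM.le
      simp only [gxw, fxw, gyw, abs_mul]
      constructor
      · calc _ ≤ |T.gx i (Sw T w a)| * |fxw T w a| + |T.gy i (Sw T w a)| * |gxw T w a| := by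
              rw [← abs_mul, ← abs_mul]; exact abs_add_le _ _
          _ ≤ M / d * |T.fx i (Sw T w a).1| * |fxw T w a| +
              η * |T.fx i (Sw T w a).1| * (R * |fxw T w a|) := by
            gcongr
            exact ih.1
          _ = (M / d + η * R) * (|T.fx i (Sw T w a).1| * |fxw T w a|) := by ring
          _ = _ := by rw [hRM]
      · refine mul_le_mul (hgf.trans ?_) ih.2 (abs_nonneg _) (abs_nonneg _)
        exact mul_le_of_le_one_left (abs_nonneg _) hη1.le
  refine ⟨R ^ 2 + 1, by positivity, fun w a ha => ?_⟩
  obtain ⟨h1, h2⟩ := key w a ha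
  have e1 := pow_le_pow_left₀ (abs_nonneg _) h1 2
  have e2 := pow_le_pow_left₀ (abs_nonneg _) h2 2
  rw [mul_pow, sq_abs, sq_abs] at e1
  rw [sq_abs, sq_abs] at e2
  linarith

/-- The singular values of `D_a S_w` are comparable over all base points,
uniformly in the word `w`. -/
lemma exists_log_alpha_sub_le (T : System I) : ∃ C, ∀ w, ∀ a ∈ sq, ∀ b ∈ sq,
    |Real.log (alpha1 T w a) - Real.log (alpha1 T w b)| ≤ C ∧
    |Real.log (alpha2 T w a) - Real.log (alpha2 T w b)| ≤ C := by
  obtain ⟨d, hd, _, _, _, _, _, h⟩ := T.exists_uniform_bounds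
  obtain ⟨α, hα, H, hH, hhol⟩ := T.holder
  obtain ⟨K, hK, hent⟩ := exists_entries_le T
  obtain ⟨C₁, hC₁⟩ := cocycle_distortion T (φ := fun i a => T.fx i a.1) (P := fxw T)
    (fun _ => rfl) (fun _ _ _ => rfl) hd hα hH (fun i a ha => (h i a ha).2.1)
    (fun i a ha b hb => ((hhol i).1 _ ha.1 _ hb.1).trans (mul_le_mul_of_nonneg_left
      (Real.rpow_le_rpow (abs_nonneg _) (abs_fst_sub_le_dE a b) hα.le) hH.le))
  obtain ⟨C₂, hC₂⟩ := cocycle_distortion T (φ := T.gy) (P := gyw T)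
    (fun _ => rfl) (fun _ _ _ => rfl) hd hα hH (fun i a ha => (h i a ha).1)
    (fun i => (hhol i).2.2)
  refine ⟨max C₁ C₂ + 2 * Real.log (2 * (1 + K)), fun w a ha b hb => ?_⟩
  obtain ⟨hfa, hf⟩ := hC₁ w a ha b hb
  obtain ⟨hga, hg⟩ := hC₂ w a ha b hb
  have hA := singular_values_lower_triangular hfa hga hK (hent w a ha)
  have hB := singular_values_lower_triangular (hC₁ w b hb a ha).1 (hC₂ w b hb a ha).1 hK
    (hent w b hb)
  have m1 := le_max_left C₁ C₂
  have m2 := le_max_right C₁ C₂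
  simp only [alpha1, alpha2, Dmat]
  simp only [abs_le] at hA hB hf hg ⊢
  refine ⟨⟨?_, ?_⟩, ?_, ?_⟩ <;> linarith

lemma IsCoding.mem_sq {T : System I} {Pi : (ℕ → I) → ℝ × ℝ} (hPi : IsCoding T Pi) (ii : ℕ → I) :
    Pi ii ∈ sq := by
  obtain ⟨a, ha, h⟩ := hPi ii 0
  rw [← h]
  exact Sw_mem_sq T _ ha

lemma tendsto_div_natCast_of_abs_sub_le {u v : ℕ → ℝ} {χ C : ℝ}
    (hu : Tendsto (fun n : ℕ => u n / n) atTop (nhds χ)) (h : ∀ n, |v n - u n| ≤ C) :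
    Tendsto (fun n : ℕ => v n / n) atTop (nhds χ) := by
  have h0 : Tendsto (fun n : ℕ => (v n - u n) / n) atTop (nhds 0) := by
    refine squeeze_zero_norm (fun n => ?_) (tendsto_const_div_atTop_nhds_zero_nat C)
    rw [norm_div, Real.norm_eq_abs, Real.norm_natCast]
    exact div_le_div_of_nonneg_right (h n) (Nat.cast_nonneg n)
  simpa [sub_div] using hu.add h0

end FFL

/-- the Lyapunov exponents may be computed at any sequence of base points. -/
theorem stmt5 {I : Type} [Fintype I] (T : System I)
    (Pi : (ℕ → I) → ℝ × ℝ) (hPi : IsCoding T Pi)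
    (ii : ℕ → I) (χ₁ χ₂ : ℝ)
    (h1 : Tendsto (fun n : ℕ => Real.log (alpha1 T (word ii n) (Pi (shiftn ii n))) / n)
      atTop (nhds χ₁))
    (h2 : Tendsto (fun n : ℕ => Real.log (alpha2 T (word ii n) (Pi (shiftn ii n))) / n)
      atTop (nhds χ₂))
    (a : ℕ → ℝ × ℝ) (ha : ∀ n, a n ∈ sq) :
    Tendsto (fun n : ℕ => Real.log (alpha1 T (word ii n) (a n)) / n) atTop (nhds χ₁) ∧
    Tendsto (fun n : ℕ => Real.log (alpha2 T (word ii n) (a n)) / n) atTop (nhds χ₂) := by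
  obtain ⟨C, hC⟩ := exists_log_alpha_sub_le T
  have hb : ∀ n, Pi (shiftn ii n) ∈ sq := fun n => hPi.mem_sq _
  exact ⟨tendsto_div_natCast_of_abs_sub_le h1 fun n => (hC _ _ (ha n) _ (hb n)).1,
    tendsto_div_natCast_of_abs_sub_le h2 fun n => (hC _ _ (ha n) _ (hb n)).2⟩
end
end

section
/- Suppose π(μ) is exact dimensional with exact dimension t. For each i ∈ Σ let (r_n(i))_{n∈ℕ} be a sequence of positive reals with r_n(i) → 0 uniformly over all i ∈ Σ. Then for m-almost every i ∈ Σ there exists a strictly increasing sequence (n_k)_{k∈ℕ} of natural numbers such that: (a) for every ε > 0 and all sufficiently large k, log π(μ)(Q₁(π(Π(σ^{n_k} i)), r_{n_k}(i))) ≤ (t − ε) log r_{n_k}(i) and log π(μ)(Q₁(π(Π(σ^{n_k} i)), r_{n_k}(i))) ≥ (t + ε) log r_{n_k}(i); and (b) lim_{k→∞} n_{k+1}/n_k = 1. -/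
open MeasureTheory Filter Set

noncomputable section

open FFL

section Recurrence

variable {α : Type*} [MeasurableSpace α] {m : Measure α} {f : α → α} {B : Set α}

/-- The points of `B` that do not come back to `B` within the first `j` iterates of `f`. -/
def noReturn (f : α → α) (B : Set α) (j : ℕ) : Set α :=
  {x | x ∈ B ∧ ∀ k, 1 ≤ k → k ≤ j → f^[k] x ∉ B}

theorem measurableSet_noReturn (hf : Measurable f) (hB : MeasurableSet B) (j : ℕ) :
    MeasurableSet (noReturn f B j) := by
  have : noReturn f B j = B ∩ ⋂ k, ⋂ (_ : 1 ≤ k), ⋂ (_ : k ≤ j), f^[k] ⁻¹' Bᶜ := by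
    ext x; simp [noReturn]
  rw [this]
  exact hB.inter <| .iInter fun k => .iInter fun _ => .iInter fun _ =>
    (hf.iterate k) hB.compl

/-- The tail sums of the return time distribution are at most the total mass:
the sets on which the last visit to `B` before time `N` happens at time `k` are disjoint. -/
theorem tsum_measure_noReturn_le (hf : MeasurePreserving f m m) (hB : MeasurableSet B) :
    ∑' j, m (noReturn f B j) ≤ m univ := by
  rw [ENNReal.tsum_eq_iSup_nat]
  refine iSup_le fun N => ?_
  have hmeas : ∀ k, MeasurableSet (f^[k] ⁻¹' noReturn f B (N - 1 - k)) := fun k =>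
    (hf.measurable.iterate k) (measurableSet_noReturn hf.measurable hB _)
  have hdisj : Set.PairwiseDisjoint (↑(Finset.range N) : Set ℕ)
      (fun k => f^[k] ⁻¹' noReturn f B (N - 1 - k)) := by
    have key : ∀ k l, k < l → l < N → Disjoint (f^[k] ⁻¹' noReturn f B (N - 1 - k))
        (f^[l] ⁻¹' noReturn f B (N - 1 - l)) := by
      intro k l hkl hl
      rw [Set.disjoint_left]
      intro x hx hy
      refine hx.2 (l - k) (by omega) (by omega) ?_
      rw [← Function.iterate_add_apply, Nat.sub_add_cancel hkl.le]
      exact hy.1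
    intro k hk l hl hkl
    simp only [Finset.coe_range, Set.mem_Iio] at hk hl
    rcases lt_or_gt_of_ne hkl with h | h
    · exact key k l h hl
    · exact (key l k h hk).symm
  calc ∑ j ∈ Finset.range N, m (noReturn f B j)
      = ∑ k ∈ Finset.range N, m (noReturn f B (N - 1 - k)) :=
        (Finset.sum_range_reflect (fun j => m (noReturn f B j)) N).symm
    _ = ∑ k ∈ Finset.range N, m (f^[k] ⁻¹' noReturn f B (N - 1 - k)) := by
        refine Finset.sum_congr rfl fun k _ => ?_
        exact ((hf.iterate k).measure_preimage
          (measurableSet_noReturn hf.measurable hB _).nullMeasurableSet).symm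
    _ = m (⋃ k ∈ Finset.range N, f^[k] ⁻¹' noReturn f B (N - 1 - k)) :=
        (measure_biUnion_finset hdisj fun k _ => hmeas k).symm
    _ ≤ m univ := measure_mono (subset_univ _)

/-- Almost surely, late visits to `B` are followed by another visit after a relatively
short time. -/
theorem ae_eventually_exists_return [IsFiniteMeasure m] (hf : MeasurePreserving f m m)
    (hB : MeasurableSet B) (q : ℕ) [NeZero q] :
    ∀ᵐ x ∂m, ∀ᶠ n in atTop, f^[n] x ∈ B → ∃ k, n < k ∧ k ≤ n + n / q ∧ f^[k] x ∈ B := by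
  have hsum : ∑' n, m (f^[n] ⁻¹' noReturn f B (n / q)) ≠ ⊤ := by
    have h1 : ∀ n, m (f^[n] ⁻¹' noReturn f B (n / q)) = m (noReturn f B (n / q)) := fun n =>
      (hf.iterate n).measure_preimage
        (measurableSet_noReturn hf.measurable hB _).nullMeasurableSet
    have h2 : ∑' n, m (noReturn f B (n / q)) = ∑' p : ℕ × Fin q, m (noReturn f B p.1) :=
      (Nat.divModEquiv q).tsum_eq (fun p : ℕ × Fin q => m (noReturn f B p.1))
    simp_rw [h1]
    rw [h2, ENNReal.tsum_prod']
    simp only [tsum_fintype, Finset.sum_const, Finset.card_univ, Fintype.card_fin, nsmul_eq_mul]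
    rw [ENNReal.tsum_mul_left]
    exact ENNReal.mul_ne_top (ENNReal.natCast_ne_top q)
      (ne_top_of_le_ne_top (measure_ne_top m univ) (tsum_measure_noReturn_le hf hB))
  filter_upwards [ae_eventually_notMem hsum] with x hx
  filter_upwards [hx] with n hn hnB
  by_contra! hcon
  refine hn ⟨hnB, fun k hk hkn => ?_⟩
  rw [← Function.iterate_add_apply, add_comm]
  exact hcon _ (by omega) (by omega)

theorem Ergodic.ae_frequently_mem [IsFiniteMeasure m] (hf : Ergodic f m)
    (hB : MeasurableSet B) (hpos : m B ≠ 0) : ∀ᵐ x ∂m, ∃ᶠ n in atTop, f^[n] x ∈ B := by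
  set W : Set α := {x | ∃ᶠ n in atTop, f^[n] x ∈ B} with hWdef
  have hW : MeasurableSet W := by
    have : W = ⋂ N : ℕ, ⋃ n, ⋃ (_ : N ≤ n), f^[n] ⁻¹' B := by
      ext x; simp [hWdef, frequently_atTop]
    rw [this]
    exact .iInter fun N => .iUnion fun n => .iUnion fun _ => (hf.measurable.iterate n) hB
  have hinv : f ⁻¹' W = W := by
    ext x
    simp only [hWdef, Set.mem_preimage, Set.mem_ofPred_eq, ← Function.iterate_succ_apply]
    exact Filter.frequently_map (m := fun n => n + 1) (P := fun n => f^[n] x ∈ B) |>.symm.trans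
      (by rw [map_add_atTop_eq_nat])
  refine (hf.toPreErgodic.ae_mem_or_ae_notMem hW hinv).resolve_right fun hnot => hpos ?_
  rw [measure_eq_zero_iff_ae_notMem]
  filter_upwards [hnot, hf.toMeasurePreserving.conservative.ae_mem_imp_frequently_image_mem
    hB.nullMeasurableSet] with x h1 h2 hxB
  exact h1 (h2 hxB)

/-- For an ergodic map, the visit times `n_k` to a set of positive measure almost surely
satisfy `n_{k+1} / n_k → 1`. -/
theorem Ergodic.ae_exists_visits [IsFiniteMeasure m] (hf : Ergodic f m)
    (hB : MeasurableSet B) (hpos : m B ≠ 0) :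
    ∀ᵐ x ∂m, ∃ nk : ℕ → ℕ, StrictMono nk ∧ (∀ k, f^[nk k] x ∈ B) ∧
      Tendsto (fun k => (nk (k + 1) : ℝ) / (nk k : ℝ)) atTop (nhds 1) := by
  have hret : ∀ᵐ x ∂m, ∀ q : ℕ, ∀ᶠ n in atTop, f^[n] x ∈ B →
      ∃ k, n < k ∧ k ≤ n + n / (q + 1) ∧ f^[k] x ∈ B :=
    ae_all_iff.2 fun q => ae_eventually_exists_return hf.toMeasurePreserving hB (q + 1)
  filter_upwards [hf.ae_frequently_mem hB hpos, hret] with x hfreq hx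
  set p : ℕ → Prop := fun n => f^[n] x ∈ B
  have hinf : (Set.ofPred p).Infinite := Nat.frequently_atTop_iff_infinite.1 hfreq
  have hmono := Nat.nth_strictMono hinf
  have htop := hmono.tendsto_atTop
  refine ⟨Nat.nth p, hmono, Nat.nth_mem_of_infinite hinf, ?_⟩
  rw [tendsto_order]
  have hge : ∀ᶠ k in atTop, 0 < Nat.nth p k := htop.eventually_gt_atTop 0
  refine ⟨fun a ha => ?_, fun b hb => ?_⟩
  · filter_upwards [hge] with k hk
    refine ha.trans_le ?_
    rw [one_le_div (by exact_mod_cast hk)]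
    exact_mod_cast (hmono k.lt_succ_self).le
  · obtain ⟨q, hq⟩ := exists_nat_one_div_lt (sub_pos.2 hb)
    filter_upwards [hge, htop.eventually (hx q)] with k hk hkret
    obtain ⟨l, hl1, hl2, hlB⟩ := hkret (Nat.nth_mem_of_infinite hinf k)
    have hle : Nat.nth p (k + 1) ≤ l := by
      by_contra! hlt
      exact absurd (Nat.le_nth_of_lt_nth_succ hlt hlB) (not_le.2 hl1)
    have hk' : (0 : ℝ) < Nat.nth p k := by exact_mod_cast hk
    rw [div_lt_iff₀ hk']
    have h1 : (Nat.nth p (k + 1) : ℝ) ≤ Nat.nth p k + ((Nat.nth p k / (q + 1) : ℕ) : ℝ) := by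
      exact_mod_cast hle.trans hl2
    have h2 : ((Nat.nth p k / (q + 1) : ℕ) : ℝ) ≤ Nat.nth p k * (1 / ((q : ℝ) + 1)) := by
      have := Nat.cast_div_le (α := ℝ) (m := Nat.nth p k) (n := q + 1)
      rw [mul_one_div]
      exact_mod_cast this
    nlinarith [mul_lt_mul_of_pos_left hq hk']

end Recurrence

section Uniform

/-- A Lusin–Egorov type selection: pointwise a.e. eventual membership can be made uniform
on a set of positive measure. -/
theorem exists_measurableSet_subset_of_ae_exists {α : Type*} [MeasurableSpace α]
    {ν : Measure α} [IsProbabilityMeasure ν] {V : ℕ → ℕ → Set α}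
    (hV : ∀ j n, MeasurableSet (V j n)) (hmono : ∀ j, Monotone (V j))
    (hae : ∀ᵐ x ∂ν, ∀ j, ∃ n, x ∈ V j n) :
    ∃ A, MeasurableSet A ∧ ν A ≠ 0 ∧ ∀ j, ∃ n, A ⊆ V j n := by
  obtain ⟨e, hepos, hesum⟩ := ENNReal.exists_pos_sum_of_countable' one_ne_zero ℕ
  have hsel : ∀ j, ∃ n, ν (V j n)ᶜ < e j := by
    intro j
    have hlim := tendsto_measure_iInter_atTop (μ := ν) (s := fun n => (V j n)ᶜ)
      (fun n => (hV j n).compl.nullMeasurableSet)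
      (fun a b hab => compl_subset_compl.2 (hmono j hab)) ⟨0, measure_ne_top _ _⟩
    have hzero : ν (⋂ n, (V j n)ᶜ) = 0 := by
      rw [measure_eq_zero_iff_ae_notMem]
      filter_upwards [hae] with x hx
      obtain ⟨n, hn⟩ := hx j
      simp only [Set.mem_iInter, Set.mem_compl_iff, not_forall, not_not]
      exact ⟨n, hn⟩
    rw [hzero] at hlim
    exact (hlim.eventually_lt_const (hepos j)).exists
  choose N hN using hsel
  refine ⟨⋂ j, V j (N j), .iInter fun j => hV j _, fun h0 => ?_,
    fun j => ⟨N j, Set.iInter_subset _ j⟩⟩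
  have h1 : ν (⋂ j, V j (N j))ᶜ < 1 := by
    rw [Set.compl_iInter]
    exact ((measure_iUnion_le _).trans (ENNReal.tsum_le_tsum fun j => (hN j).le)).trans_lt hesum
  rw [prob_compl_eq_one_sub (.iInter fun j => hV j _), h0] at h1
  simp at h1

theorem rpow_le_of_forall_rat {G : ℝ → ℝ} (hG : Monotone G) {a δ : ℝ}
    (h : ∀ q : ℚ, 0 < (q : ℝ) → (q : ℝ) < δ → (q : ℝ) ^ a ≤ G q) {r : ℝ} (hr : 0 < r)
    (hrδ : r < δ) : r ^ a ≤ G r := by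
  by_contra! hlt
  have hev : ∀ᶠ y in nhdsWithin r (Set.Iio r), G r < y ^ a :=
    ((Real.continuousAt_rpow_const r a (.inl hr.ne')).eventually_const_lt hlt).filter_mono
      nhdsWithin_le_nhds
  obtain ⟨l, hl, hsub⟩ := mem_nhdsLT_iff_exists_Ioo_subset.1 hev
  obtain ⟨q, hq1, hq2⟩ := exists_rat_btwn (max_lt hl hr)
  have h1 : G r < (q : ℝ) ^ a := hsub ⟨(le_max_left _ _).trans_lt hq1, hq2⟩
  exact absurd ((h q ((le_max_right _ _).trans_lt hq1) (hq2.trans hrδ)).trans (hG hq2.le))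
    (not_le.2 h1)

theorem le_rpow_of_forall_rat {G : ℝ → ℝ} (hG : Monotone G) {a δ : ℝ}
    (h : ∀ q : ℚ, 0 < (q : ℝ) → (q : ℝ) < δ → G q ≤ (q : ℝ) ^ a) {r : ℝ} (hr : 0 < r)
    (hrδ : r < δ) : G r ≤ r ^ a := by
  by_contra! hlt
  have hev : ∀ᶠ y in nhdsWithin r (Set.Ioi r), y ^ a < G r :=
    ((Real.continuousAt_rpow_const r a (.inl hr.ne')).eventually_lt_const hlt).filter_mono
      nhdsWithin_le_nhds
  obtain ⟨u, hu, hsub⟩ := mem_nhdsGT_iff_exists_Ioo_subset.1 hev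
  obtain ⟨q, hq1, hq2⟩ := exists_rat_btwn (lt_min hu hrδ)
  have h1 : (q : ℝ) ^ a < G r := hsub ⟨hq1, hq2.trans_le (min_le_left _ _)⟩
  exact absurd ((hG hq1.le).trans (h q (hr.trans hq1) (hq2.trans_le (min_le_right _ _))))
    (not_le.2 h1)

end Uniform

section Intervals

theorem monotone_measureReal_Q1 (ν : Measure ℝ) [IsFiniteMeasure ν] (x : ℝ) :
    Monotone fun r => ν.real (Q1 x r) := fun r s hrs =>
  measureReal_mono (Set.Icc_subset_Icc (by linarith) (by linarith))

theorem measurable_measureReal_Q1 (ν : Measure ℝ) [IsFiniteMeasure ν] (r : ℝ) :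
    Measurable fun x => ν.real (Q1 x r) := by
  have hS : MeasurableSet ({p : ℝ × ℝ | p.1 - r / 2 ≤ p.2} ∩ {p | p.2 ≤ p.1 + r / 2}) :=
    (measurableSet_le (by fun_prop) (by fun_prop)).inter
      (measurableSet_le (by fun_prop) (by fun_prop))
  exact (measurable_measure_prodMk_left (ν := ν) hS).ennreal_toReal

/-- In the definition of exact dimensionality, balls of radius `r` can be replaced by
intervals of length `r`. -/
theorem tendsto_log_Q1 {ν : Measure ℝ} {t x : ℝ}
    (h : Tendsto (fun r => Real.log (ν (Metric.closedBall x r)).toReal / Real.log r)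
      (nhdsWithin 0 (Set.Ioi 0)) (nhds t)) :
    Tendsto (fun r => Real.log (ν.real (Q1 x r)) / Real.log r)
      (nhdsWithin 0 (Set.Ioi 0)) (nhds t) := by
  have hhalf : Tendsto (fun r : ℝ => r / 2) (nhdsWithin 0 (Set.Ioi 0))
      (nhdsWithin 0 (Set.Ioi 0)) := by
    refine tendsto_nhdsWithin_iff.2 ⟨?_, ?_⟩
    · exact ((continuous_id.div_const (2 : ℝ)).tendsto' 0 0 (by simp)).mono_left
        nhdsWithin_le_nhds
    · filter_upwards [self_mem_nhdsWithin] with r hr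
      exact half_pos (Set.mem_Ioi.1 hr)
  have hlog := Real.tendsto_log_nhdsGT_zero
  have hratio : Tendsto (fun r : ℝ => Real.log (r / 2) / Real.log r)
      (nhdsWithin 0 (Set.Ioi 0)) (nhds 1) := by
    have h0 : Tendsto (fun r : ℝ => 1 - Real.log 2 / Real.log r)
        (nhdsWithin 0 (Set.Ioi 0)) (nhds (1 - 0)) :=
      tendsto_const_nhds.sub (hlog.const_div_atBot _)
    rw [sub_zero] at h0
    refine h0.congr' ?_
    filter_upwards [self_mem_nhdsWithin, hlog.eventually_lt_atBot 0] with r hr hneg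
    rw [Real.log_div (ne_of_gt hr) two_ne_zero, sub_div, div_self hneg.ne]
  have hprod := (h.comp hhalf).mul hratio
  rw [mul_one] at hprod
  refine hprod.congr' ?_
  filter_upwards [hhalf.eventually (hlog.eventually_lt_atBot 0)] with r hneg
  have hball : Metric.closedBall x (r / 2) = Q1 x r := Real.closedBall_eq_Icc
  simp only [Function.comp_apply, hball, Measure.real]
  exact div_mul_div_cancel₀ hneg.ne

/-- If `ν` is exact dimensional, the scaling of intervals is uniform on a set of positive
measure. -/
theorem exists_uniform_scaling {ν : Measure ℝ} [IsProbabilityMeasure ν] {t : ℝ}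
    (hν : ExactDim1 ν t) :
    ∃ A, MeasurableSet A ∧ ν A ≠ 0 ∧ ∀ ε > (0 : ℝ), ∃ δ > (0 : ℝ), ∀ x ∈ A, ∀ r, 0 < r → r < δ →
      Real.log (ν.real (Q1 x r)) ≤ (t - ε) * Real.log r ∧
      (t + ε) * Real.log r ≤ Real.log (ν.real (Q1 x r)) := by
  let V : ℕ → ℕ → Set ℝ := fun j n => {x | ∀ q : ℚ, 0 < (q : ℝ) → (q : ℝ) < 1 / ((n : ℝ) + 1) →
    (q : ℝ) ^ (t + 1 / ((j : ℝ) + 1)) ≤ ν.real (Q1 x q) ∧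
    ν.real (Q1 x q) ≤ (q : ℝ) ^ (t - 1 / ((j : ℝ) + 1))}
  have hVmeas : ∀ j n, MeasurableSet (V j n) := by
    intro j n
    simp only [V, Set.ofPred_forall]
    exact .iInter fun q => .iInter fun _ => .iInter fun _ =>
      (measurableSet_le measurable_const (measurable_measureReal_Q1 ν q)).inter
        (measurableSet_le (measurable_measureReal_Q1 ν q) measurable_const)
  have hVmono : ∀ j, Monotone (V j) := fun j a b hab x hx q hq0 hq =>
    hx q hq0 (hq.trans_le (Nat.one_div_le_one_div hab))
  have hVae : ∀ᵐ x ∂ν, ∀ j, ∃ n, x ∈ V j n := by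
    filter_upwards [hν, ν.support_mem_ae] with x hx hsupp j
    have hpos : ∀ r : ℝ, 0 < r → 0 < ν.real (Q1 x r) := fun r hr =>
      ENNReal.toReal_pos ((Measure.mem_support_iff_forall x).1 hsupp _
        (Icc_mem_nhds (by linarith) (by linarith))).ne' (measure_ne_top _ _)
    have hj : (0 : ℝ) < 1 / ((j : ℝ) + 1) := by positivity
    have hlim := tendsto_log_Q1 hx
    have hev : ∀ᶠ r in nhdsWithin (0 : ℝ) (Set.Ioi 0),
        r ^ (t + 1 / ((j : ℝ) + 1)) ≤ ν.real (Q1 x r) ∧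
        ν.real (Q1 x r) ≤ r ^ (t - 1 / ((j : ℝ) + 1)) := by
      filter_upwards [self_mem_nhdsWithin, Real.tendsto_log_nhdsGT_zero.eventually_lt_atBot 0,
        hlim.eventually_const_lt (sub_lt_self t hj),
        hlim.eventually_lt_const (lt_add_of_pos_right t hj)] with r hr hneg hlo hhi
      rw [lt_div_iff_of_neg hneg] at hlo
      rw [div_lt_iff_of_neg hneg] at hhi
      rw [Real.rpow_le_iff_le_log hr (hpos r hr), Real.le_rpow_iff_log_le (hpos r hr) hr]
      exact ⟨hhi.le, hlo.le⟩
    obtain ⟨u, hu, hsub⟩ := mem_nhdsGT_iff_exists_Ioo_subset.1 hev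
    obtain ⟨n, hn⟩ := exists_nat_one_div_lt (Set.mem_Ioi.1 hu)
    exact ⟨n, fun q hq0 hq => hsub ⟨hq0, hq.trans hn⟩⟩
  obtain ⟨A, hA, hA0, hsub⟩ := exists_measurableSet_subset_of_ae_exists hVmeas hVmono hVae
  refine ⟨A, hA, hA0, fun ε hε => ?_⟩
  obtain ⟨j, hj⟩ := exists_nat_one_div_lt hε
  obtain ⟨n, hn⟩ := hsub j
  refine ⟨1 / ((n : ℝ) + 1), by positivity, fun x hx r hr hrn => ?_⟩
  have hlo := rpow_le_of_forall_rat (monotone_measureReal_Q1 ν x)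
    (fun q h0 h1 => (hn hx q h0 h1).1) hr hrn
  have hhi := le_rpow_of_forall_rat (monotone_measureReal_Q1 ν x)
    (fun q h0 h1 => (hn hx q h0 h1).2) hr hrn
  have hpos : 0 < ν.real (Q1 x r) := (Real.rpow_pos_of_pos hr _).trans_le hlo
  have hneg : Real.log r ≤ 0 := Real.log_nonpos hr.le <| hrn.le.trans <| by
    simpa using Nat.one_div_le_one_div (α := ℝ) (Nat.zero_le n)
  have hlo' := Real.log_le_log (Real.rpow_pos_of_pos hr _) hlo
  have hhi' := Real.log_le_log hpos hhi
  rw [Real.log_rpow hr] at hlo' hhi'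
  exact ⟨hhi'.trans (mul_le_mul_of_nonpos_right (by linarith) hneg),
    (mul_le_mul_of_nonpos_right (by linarith) hneg).trans hlo'⟩

end Intervals

theorem shift_iterate {I : Type} (ii : ℕ → I) (n : ℕ) : shift^[n] ii = shiftn ii n := by
  induction n with
  | zero => rfl
  | succ n ih =>
    rw [Function.iterate_succ_apply', ih]
    funext k
    simp only [shift, shiftn]
    congr 1
    ring

/-- for a.e. `i` there is a subsequence with ratios tending to 1 along
which the projected measure of the relevant intervals scales correctly. -/
theorem stmt9 {I : Type} [Fintype I] [MeasurableSpace I] (T : System I)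
    (F : Set (ℝ × ℝ)) (hF : IsAttractor T F) (hSSC : SSC T F)
    (Pi : (ℕ → I) → ℝ × ℝ) (hPi : IsCoding T Pi) (hPim : Measurable Pi)
    (m : Measure (ℕ → I)) [IsProbabilityMeasure m]
    (hshift : MeasurePreserving (shift : (ℕ → I) → ℕ → I) m m)
    (L : ℝ) (hQB : QuasiBernoulli m L)
    (herg : Ergodic (shift : (ℕ → I) → ℕ → I) m)
    (t : ℝ) (hproj : ExactDim1 ((m.map Pi).map Prod.fst) t)
    (r : (ℕ → I) → ℕ → ℝ) (hrpos : ∀ ii n, 0 < r ii n)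
    (hrunif : ∀ ε > (0:ℝ), ∃ N : ℕ, ∀ n ≥ N, ∀ ii : ℕ → I, r ii n < ε) :
    ∀ᵐ ii ∂m, ∃ nk : ℕ → ℕ, StrictMono nk ∧
      (∀ ε > (0:ℝ), ∃ K : ℕ, ∀ k ≥ K,
        Real.log (((m.map Pi).map Prod.fst)
            (Q1 (Pi (shiftn ii (nk k))).1 (r ii (nk k)))).toReal ≤
          (t - ε) * Real.log (r ii (nk k)) ∧
        (t + ε) * Real.log (r ii (nk k)) ≤
          Real.log (((m.map Pi).map Prod.fst)
            (Q1 (Pi (shiftn ii (nk k))).1 (r ii (nk k)))).toReal) ∧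
      Tendsto (fun k => (nk (k+1) : ℝ) / (nk k : ℝ)) atTop (nhds 1) := by
  have hfst : Measurable fun ii => (Pi ii).1 := measurable_fst.comp hPim
  have hmap : (m.map Pi).map Prod.fst = m.map fun ii => (Pi ii).1 :=
    Measure.map_map measurable_fst hPim
  rw [hmap] at hproj ⊢
  have := Measure.isProbabilityMeasure_map (μ := m) hfst.aemeasurable
  obtain ⟨A, hA, hA0, hscale⟩ := exists_uniform_scaling hproj
  rw [Measure.map_apply hfst hA] at hA0
  filter_upwards [herg.ae_exists_visits (hfst hA) hA0] with ii hii
  obtain ⟨nk, hmono, hvisit, hlim⟩ := hii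
  refine ⟨nk, hmono, fun ε hε => ?_, hlim⟩
  obtain ⟨δ, hδ, hbound⟩ := hscale ε hε
  obtain ⟨N, hN⟩ := hrunif δ hδ
  refine ⟨N, fun k hk => hbound _ ?_ _ (hrpos _ _) (hN _ (hk.trans hmono.le_apply) _)⟩
  rw [← shift_iterate]
  exact hvisit k
end
end
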